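/- arXiv:1910.03917 — 3 statements merged into one kernel-verified Lean document; each statement's English description precedes it below -/
import Mathlib

section
/- If a clause set R(η) over a language L containing 0 and s is refuted by a clause set cycle, then ¬R is a semantic consequence of the theory I∃₁(L) of induction for ∃₁ formulas; that is, every model of I∃₁(L) satisfies ∀x ¬R(x). -/
open FirstOrder Language Structure

universe u v w u'

namespace ClauseSetCycles

variable {L : FirstOrder.Language.{u, v}}

/-- A literal is an atomic formula or the negation of an atomic formula. -/
inductive IsLiteral {α : Type u'} : ∀ {n : ℕ}, L.BoundedFormula α n → Prop
  | atom {n} {φ : L.BoundedFormula α n} : φ.IsAtomic → IsLiteral φ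
  | negAtom {n} {φ : L.BoundedFormula α n} : φ.IsAtomic → IsLiteral φ.not

/-- A disjunction of literals (identifying, as usual, a formula such as
`a₁ → (b₁ ∨ b₂)` with its negation normal form `¬a₁ ∨ b₁ ∨ b₂`). -/
inductive IsClauseMatrix {α : Type u'} : ∀ {n : ℕ}, L.BoundedFormula α n → Prop
  | lit {n} {φ : L.BoundedFormula α n} : IsLiteral φ → IsClauseMatrix φ
  | sup {n} {φ ψ : L.BoundedFormula α n} :
      IsClauseMatrix φ → IsClauseMatrix ψ → IsClauseMatrix (φ ⊔ ψ)
  | impAtom {n} {φ ψ : L.BoundedFormula α n} :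
      φ.IsAtomic → IsClauseMatrix ψ → IsClauseMatrix (φ.imp ψ)

/-- A clause is a universally quantified disjunction of literals. -/
inductive IsClause {α : Type u'} : ∀ {n : ℕ}, L.BoundedFormula α n → Prop
  | matrix {n} {φ : L.BoundedFormula α n} : IsClauseMatrix φ → IsClause φ
  | all {n} {φ : L.BoundedFormula α (n + 1)} : IsClause φ → IsClause φ.all

/-- A clause set is a conjunction of clauses. -/
inductive IsClauseSet {α : Type u'} : ∀ {n : ℕ}, L.BoundedFormula α n → Prop
  | clause {n} {φ : L.BoundedFormula α n} : IsClause φ → IsClauseSet φ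
  | inf {n} {φ ψ : L.BoundedFormula α n} :
      IsClauseSet φ → IsClauseSet ψ → IsClauseSet (φ ⊓ ψ)

/-- An `∃₁` formula: a quantifier-free formula preceded by a block of
existential quantifiers. -/
inductive IsExistsQF {α : Type u'} : ∀ {n : ℕ}, L.BoundedFormula α n → Prop
  | of_isQF {n} {φ : L.BoundedFormula α n} : φ.IsQF → IsExistsQF φ
  | ex {n} {φ : L.BoundedFormula α (n + 1)} : IsExistsQF φ → IsExistsQF φ.ex

variable (zero : L.Constants) (succ : L.Functions 1)

/-- The interpretation of the successor symbol in a structure. -/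
def sFun {M : Type w} [L.Structure M] (a : M) : M :=
  funMap succ ![a]

/-- The interpretation of the zero symbol in a structure. -/
def zElt (M : Type w) [L.Structure M] : M :=
  funMap zero ![]

/-- The interpretation of the numeral `s^k(0)` in a structure. -/
def numElt (M : Type w) [L.Structure M] (k : ℕ) : M :=
  (sFun succ)^[k] (zElt zero M)

/-- Universal quantification of the distinguished (`Sum.inr`) free variable. -/
def close1 {α : Type u'} (φ : L.Formula (α ⊕ Fin 1)) : L.Formula α :=
  (BoundedFormula.relabel (Sum.elim Sum.inl (fun _ => Sum.inr (0 : Fin 1))) φ).all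

/-- Universal closure of a formula with finitely many free variables. -/
def closeAll {k : ℕ} (φ : L.Formula (Fin k)) : L.Sentence :=
  (BoundedFormula.relabel (fun i => (Sum.inr i : Empty ⊕ Fin k)) φ).alls

/-- The induction axiom `Ind_x ψ` for a formula `ψ(x, z̄)`, where the
induction variable `x` is the `Sum.inr` variable and the parameters
`z̄` are the `Sum.inl` variables:
`∀ z̄ (ψ(0,z̄) → ∀x (ψ(x,z̄) → ψ(s(x),z̄)) → ∀x ψ(x,z̄))`. -/
def indAxiom {k : ℕ} (ψ : L.Formula (Fin k ⊕ Fin 1)) : L.Sentence :=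
  closeAll
    ((ψ.subst (Sum.elim Term.var fun _ => Constants.term zero)).imp
      ((close1 (ψ.imp
          (ψ.subst (Sum.elim (fun i => Term.var (Sum.inl i))
            fun _ => Functions.apply₁ succ (Term.var (Sum.inr 0)))))).imp
        (close1 ψ)))

/-- The theory `I∃₁(L)` of induction for `∃₁` formulas. -/
def IndE1 : L.Theory :=
  { σ | ∃ (k : ℕ) (ψ : L.Formula (Fin k ⊕ Fin 1)), IsExistsQF ψ ∧ σ = indAxiom zero succ ψ }

/-- The theory `IOpen(L)` of induction for quantifier-free formulas. -/
def IOpenTh : L.Theory :=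
  { σ | ∃ (k : ℕ) (ψ : L.Formula (Fin k ⊕ Fin 1)), ψ.IsQF ∧ σ = indAxiom zero succ ψ }

end ClauseSetCycles

namespace ClauseSetCycles

open BoundedFormula

section ExistsQF

variable {L : FirstOrder.Language.{u, v}} {α β : Type u'}

theorem IsExistsQF.castLE {l : ℕ} {φ : L.BoundedFormula α l} (hφ : IsExistsQF φ) :
    ∀ {n : ℕ} (h : l ≤ n), IsExistsQF (φ.castLE h) := by
  induction hφ with
  | of_isQF hφ => exact fun _ => .of_isQF hφ.castLE
  | ex _ ih => exact fun h => .ex (ih (Nat.succ_le_succ h))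

theorem IsExistsQF.liftAt {n k m : ℕ} {φ : L.BoundedFormula α n} (hφ : IsExistsQF φ) :
    IsExistsQF (φ.liftAt k m) := by
  induction hφ with
  | of_isQF hφ => exact .of_isQF hφ.liftAt
  | ex _ ih => exact .ex (ih.castLE _)

theorem isQF_subst {n : ℕ} {φ : L.BoundedFormula α n} (hφ : φ.IsQF) (f : α → L.Term β) :
    (φ.subst f).IsQF := by
  induction hφ with
  | falsum => exact .falsum
  | of_isAtomic h =>
    cases h with
    | equal _ _ => exact (IsAtomic.equal _ _).isQF
    | rel _ _ => exact (IsAtomic.rel _ _).isQF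
  | imp _ _ ih₁ ih₂ => exact ih₁.imp ih₂

theorem IsExistsQF.subst {n : ℕ} {φ : L.BoundedFormula α n} (hφ : IsExistsQF φ)
    (f : α → L.Term β) : IsExistsQF (φ.subst f) := by
  induction hφ with
  | of_isQF hφ => exact .of_isQF (isQF_subst hφ f)
  | ex _ ih => exact .ex ih

theorem IsClauseMatrix.isQF {n : ℕ} {φ : L.BoundedFormula α n} (hφ : IsClauseMatrix φ) :
    φ.IsQF := by
  induction hφ with
  | lit h =>
    cases h with
    | atom h => exact h.isQF
    | negAtom h => exact h.isQF.not
  | sup _ _ ih₁ ih₂ => exact ih₁.sup ih₂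
  | impAtom h _ ih => exact h.isQF.imp ih

variable (M : Type w) [L.Structure M]

theorem IsExistsQF.exists_sup [Nonempty M] {n : ℕ} {φ ψ : L.BoundedFormula α n} (hφ : IsExistsQF φ)
    (hψ : IsExistsQF ψ) : ∃ θ : L.BoundedFormula α n, IsExistsQF θ ∧
      ∀ (v : α → M) (xs : Fin n → M), θ.Realize v xs ↔ φ.Realize v xs ∨ ψ.Realize v xs := by
  induction hφ with
  | of_isQF hφ =>
    induction hψ with
    | of_isQF hψ => exact ⟨_, .of_isQF (hφ.sup hψ), fun _ _ => realize_sup⟩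
    | @ex m _ _ ih =>
      obtain ⟨θ, hθ, h⟩ := ih (hφ.liftAt (k := 1) (m := m))
      refine ⟨θ.ex, hθ.ex, fun v xs => ?_⟩
      simp [h, exists_or]
  | @ex m _ _ ih =>
    obtain ⟨θ, hθ, h⟩ := ih (hψ.liftAt (k := 1) (m := m))
    refine ⟨θ.ex, hθ.ex, fun v xs => ?_⟩
    simp [h, exists_or]

theorem IsClause.exists_not {n : ℕ} {φ : L.BoundedFormula α n} (hφ : IsClause φ) :
    ∃ θ : L.BoundedFormula α n, IsExistsQF θ ∧
      ∀ (v : α → M) (xs : Fin n → M), θ.Realize v xs ↔ ¬ φ.Realize v xs := by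
  induction hφ with
  | matrix hφ => exact ⟨_, .of_isQF hφ.isQF.not, fun _ _ => realize_not⟩
  | all _ ih =>
    obtain ⟨θ, hθ, h⟩ := ih
    refine ⟨θ.ex, hθ.ex, fun v xs => ?_⟩
    simp [h]

theorem IsClauseSet.exists_not [Nonempty M] {n : ℕ} {φ : L.BoundedFormula α n} (hφ : IsClauseSet φ) :
    ∃ θ : L.BoundedFormula α n, IsExistsQF θ ∧
      ∀ (v : α → M) (xs : Fin n → M), θ.Realize v xs ↔ ¬ φ.Realize v xs := by
  induction hφ with
  | clause hφ => exact hφ.exists_not M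
  | inf _ _ ih₁ ih₂ =>
    obtain ⟨θ₁, hθ₁, h₁⟩ := ih₁
    obtain ⟨θ₂, hθ₂, h₂⟩ := ih₂
    obtain ⟨θ, hθ, h⟩ := hθ₁.exists_sup M hθ₂
    refine ⟨θ, hθ, fun v xs => ?_⟩
    rw [h, h₁, h₂, realize_inf, not_and_or]

end ExistsQF

section Induction

variable {L : FirstOrder.Language.{u, v}} {zero : L.Constants} {succ : L.Functions 1}
  {M : Type w} [L.Structure M]

theorem realize_close1 {α : Type u'} (φ : L.Formula (α ⊕ Fin 1)) (v : α → M) :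
    (close1 φ).Realize v ↔ ∀ a : M, φ.Realize (Sum.elim v fun _ => a) := by
  unfold close1 Formula.Realize
  rw [realize_all]
  refine forall_congr' fun a => ?_
  rw [realize_relabel, iff_eq_eq]
  congr 1
  · ext (i | i)
    · rfl
    · simp [Fin.snoc]
  · exact Subsingleton.elim _ _

theorem realize_closeAll {k : ℕ} (φ : L.Formula (Fin k)) :
    M ⊨ closeAll φ ↔ ∀ v : Fin k → M, φ.Realize v := by
  unfold closeAll Sentence.Realize
  rw [realize_alls]
  exact forall_congr' fun _ => Formula.realize_relabel_sumInr φ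

theorem realize_indAxiom {k : ℕ} (ψ : L.Formula (Fin k ⊕ Fin 1)) :
    M ⊨ indAxiom zero succ ψ ↔ ∀ v : Fin k → M,
      ψ.Realize (Sum.elim v fun _ => zElt zero M) →
      (∀ a : M, ψ.Realize (Sum.elim v fun _ => a) →
        ψ.Realize (Sum.elim v fun _ => sFun succ a)) →
      ∀ a : M, ψ.Realize (Sum.elim v fun _ => a) := by
  have h₀ (v : Fin k → M) :
      (fun i => ((Sum.elim Term.var fun _ => Constants.term zero :
        Fin k ⊕ Fin 1 → L.Term (Fin k)) i).realize v) = Sum.elim v fun _ => zElt zero M := by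
    ext (i | i)
    · rfl
    · simp only [Sum.elim_inr, zElt, Constants.term, Term.realize]
      congr 1
      exact Subsingleton.elim _ _
  have h₁ (v : Fin k → M) (a : M) :
      (fun i => ((Sum.elim (fun i => Term.var (Sum.inl i))
        fun _ => Functions.apply₁ succ (Term.var (Sum.inr 0)) :
        Fin k ⊕ Fin 1 → L.Term (Fin k ⊕ Fin 1)) i).realize (Sum.elim v fun _ => a)) =
        Sum.elim v fun _ => sFun succ a := by
    ext (i | i)
    · rfl
    · simp [sFun]
  unfold indAxiom
  rw [realize_closeAll]
  refine forall_congr' fun v => ?_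
  rw [Formula.realize_imp, Formula.realize_imp, realize_close1, realize_close1]
  simp only [Formula.realize_imp]
  simp only [Formula.Realize, realize_subst, h₀, h₁]

/-- Models of `I∃₁(L)` satisfy induction for the sets defined by `∃₁` formulas. -/
theorem IsExistsQF.induction (hM : M ⊨ IndE1 zero succ) {φ : L.Formula Unit}
    (hφ : IsExistsQF φ) (h0 : φ.Realize fun _ => zElt zero M)
    (hs : ∀ a : M, φ.Realize (fun _ => a) → φ.Realize fun _ => sFun succ a) (a : M) :
    φ.Realize fun _ => a := by
  have hax := (realize_indAxiom _).1 <| hM.realize_of_mem _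
    ⟨0, φ.subst fun _ => Term.var (Sum.inr 0), hφ.subst _, rfl⟩
  simp only [Formula.Realize, realize_subst, Term.realize_var, Sum.elim_inr] at hax
  exact hax Fin.elim0 h0 hs a

theorem eq_zElt_or_exists_eq_sFun (hM : M ⊨ IndE1 zero succ) (a : M) :
    a = zElt zero M ∨ ∃ b : M, a = sFun succ b := by
  let x : L.Term (Unit ⊕ Fin 1) := Term.var (Sum.inl ())
  let y : L.Term (Unit ⊕ Fin 1) := Term.var (Sum.inr 0)
  let χ : L.Formula Unit :=
    (x.bdEqual (Term.func zero ![]) ⊔ x.bdEqual (Functions.apply₁ succ y)).ex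
  have hχ : IsExistsQF χ :=
    .ex <| .of_isQF <| (IsAtomic.equal _ _).isQF.sup (IsAtomic.equal _ _).isQF
  have key (c : M) :
      χ.Realize (fun _ => c) ↔ ∃ b : M, c = zElt zero M ∨ c = sFun succ b := by
    have hz (b : M) : (Term.func zero ![] : L.Term (Unit ⊕ Fin 1)).realize
        (Sum.elim (fun _ => c) (Fin.snoc default b)) = zElt zero M := by
      simp only [Term.realize, zElt]
      congr 1
      exact Subsingleton.elim _ _
    simp only [χ, Formula.Realize, realize_ex, realize_sup, realize_bdEqual, hz]
    simp [x, y, sFun, Fin.snoc]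
  have h := hχ.induction hM ((key _).2 ⟨zElt zero M, .inl rfl⟩)
    (fun c _ => (key _).2 ⟨c, .inr rfl⟩) a
  obtain ⟨b, hb | hb⟩ := (key a).1 h
  · exact .inl hb
  · exact .inr ⟨b, hb⟩

theorem exists_eq_numElt_or_exists_eq_iterate (hM : M ⊨ IndE1 zero succ) (n : ℕ) (a : M) :
    (∃ k < n, a = numElt zero succ M k) ∨ ∃ b : M, a = (sFun succ)^[n] b := by
  induction n with
  | zero => exact .inr ⟨a, rfl⟩
  | succ n ih =>
    obtain ⟨k, hk, h⟩ | ⟨b, rfl⟩ := ih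
    · exact .inl ⟨k, hk.trans n.lt_succ_self, h⟩
    · obtain rfl | ⟨c, rfl⟩ := eq_zElt_or_exists_eq_sFun hM b
      · exact .inl ⟨n, n.lt_succ_self, rfl⟩
      · exact .inr ⟨c, rfl⟩

end Induction

/-- If a clause set `R(η)` over a language `L` containing `0` and `s` is
refuted by a clause set cycle `S(η)` (i.e. `S` is a clause set with `S(s(η)) ⊨ S(η)` and
`S(0) ⊨ ⊥`, and there is `n ∈ ℕ` with `R(s^n(η)) ⊨ S(η)` and `R(k̄) ⊨ ⊥` for all `k < n`),
then `¬R` is a semantic consequence of the theory `I∃₁(L)` of induction for `∃₁` formulas: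
every model of `I∃₁(L)` satisfies `∀x ¬R(x)`. -/
theorem statement0 {L : FirstOrder.Language.{u, v}} (zero : L.Constants) (succ : L.Functions 1)
    (R : L.Formula Unit) (hR : IsClauseSet R)
    (S : L.Formula Unit) (hS : IsClauseSet S)
    -- `S(s(η)) ⊨ S(η)`
    (hcycStep : ∀ (M : Type w) [L.Structure M] [Nonempty M] (a : M),
      S.Realize (fun _ => sFun succ a) → S.Realize (fun _ => a))
    -- `S(0) ⊨ ⊥`
    (hcycZero : ∀ (M : Type w) [L.Structure M] [Nonempty M],
      ¬ S.Realize (fun _ => zElt zero M))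
    (n : ℕ)
    -- `R(s^n(η)) ⊨ S(η)`
    (hrefStep : ∀ (M : Type w) [L.Structure M] [Nonempty M] (a : M),
      R.Realize (fun _ => (sFun succ)^[n] a) → S.Realize (fun _ => a))
    -- `R(k̄) ⊨ ⊥` for all `k ∈ {0, …, n-1}`
    (hrefBase : ∀ k < n, ∀ (M : Type w) [L.Structure M] [Nonempty M],
      ¬ R.Realize (fun _ => numElt zero succ M k))
    -- every model of `I∃₁(L)` satisfies `∀x ¬R(x)`
    (M : Type w) [L.Structure M] [Nonempty M] (hM : M ⊨ IndE1 zero succ) (a : M) :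
    ¬ R.Realize (fun _ => a) := by
  obtain ⟨θ, hθ, h⟩ := hS.exists_not M
  have hS' (b : M) : ¬ S.Realize (fun _ => b) :=
    (h _ _).1 <| hθ.induction hM ((h _ _).2 (hcycZero M))
      (fun c hc => (h _ _).2 fun hc' => (h _ _).1 hc (hcycStep M c hc')) b
  obtain ⟨k, hk, rfl⟩ | ⟨b, rfl⟩ := exists_eq_numElt_or_exists_eq_iterate hM n a
  · exact hrefBase k hk M
  · exact fun hb => hS' b (hrefStep M b hb)

end ClauseSetCycles
end

section
/- Let M be a model of T_▷^I, let φ(x,ȳ) be a simple atomic L_▷-formula, and let b̄ be a tuple of elements of M. Then either φ(a,b̄) holds in M for every a ∈ M, or every set of pairwise comparable solutions of φ(x,b̄) in M is finite. -/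
open FirstOrder Language Structure

universe u u'

namespace TriangularNumbers

/-- The function symbols of the language `L_▷`: `0`, `s`, `p`, `+`. -/
inductive TriFunc : ℕ → Type
  | zero : TriFunc 0
  | succ : TriFunc 1
  | pred : TriFunc 1
  | plus : TriFunc 2

/-- The relation symbols of the language `L_▷`: the binary symbol `▷`. -/
inductive TriRel : ℕ → Type
  | tri : TriRel 2

/-- The language `L_▷` with function symbols `0`, `s`, `p`, `+` and a binary
predicate symbol `▷`. -/
def LTri : FirstOrder.Language := ⟨TriFunc, TriRel⟩

def fZero : LTri.Constants := TriFunc.zero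
def fSucc : LTri.Functions 1 := TriFunc.succ
def fPred : LTri.Functions 1 := TriFunc.pred
def fPlus : LTri.Functions 2 := TriFunc.plus
def rTri : LTri.Relations 2 := TriRel.tri

/-- The term `0`. -/
def zT {α : Type u'} : LTri.Term α := Constants.term fZero
/-- The term `s(t)`. -/
def sT {α : Type u'} (t : LTri.Term α) : LTri.Term α := Functions.apply₁ fSucc t
/-- The term `p(t)`. -/
def pT {α : Type u'} (t : LTri.Term α) : LTri.Term α := Functions.apply₁ fPred t
/-- The term `t + u`. -/
def aT {α : Type u'} (t u : LTri.Term α) : LTri.Term α := Functions.apply₂ fPlus t u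

/-- (A1) `∀x s(x) ≠ 0`. -/
def axA1 : LTri.Sentence := ∀' ∼(sT &0 =' zT)
/-- (A2) `p(0) = 0`. -/
def axA2 : LTri.Sentence := pT zT =' zT
/-- (A3) `∀x p(s(x)) = x`. -/
def axA3 : LTri.Sentence := ∀' (pT (sT &0) =' &0)
/-- (A4) `∀x x + 0 = x`. -/
def axA4 : LTri.Sentence := ∀' (aT &0 zT =' &0)
/-- (A5) `∀x∀y x + s(y) = s(x + y)`. -/
def axA5 : LTri.Sentence := ∀' ∀' (aT &0 (sT &1) =' sT (aT &0 &1))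
/-- (A6) `0 ▷ 0`. -/
def axA6 : LTri.Sentence := rTri.boundedFormula₂ zT zT
/-- (A7) `∀x∀y (x ▷ y → s(x) ▷ s(x) + y)`. -/
def axA7 : LTri.Sentence :=
  ∀' ∀' (rTri.boundedFormula₂ &0 &1 ⟹ rTri.boundedFormula₂ (sT &0) (aT (sT &0) &1))
/-- (A8) `∀x∀y (s(x) ▷ s(x) + y → x ▷ y)`. -/
def axA8 : LTri.Sentence :=
  ∀' ∀' (rTri.boundedFormula₂ (sT &0) (aT (sT &0) &1) ⟹ rTri.boundedFormula₂ &0 &1)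
/-- (A9) `∀x∀y∀z (x ▷ y ∧ x ▷ z → y = z)`. -/
def axA9 : LTri.Sentence :=
  ∀' ∀' ∀' ((rTri.boundedFormula₂ &0 &1 ⊓ rTri.boundedFormula₂ &0 &2) ⟹ (&1 =' &2))

/-- The theory `T_▷`, axiomatized by (A1)–(A9). -/
def TTri : LTri.Theory := {axA1, axA2, axA3, axA4, axA5, axA6, axA7, axA8, axA9}

/-- (B1) `∀x (x ≠ 0 → x = s(p(x)))`. -/
def axB1 : LTri.Sentence := ∀' (∼(&0 =' zT) ⟹ (&0 =' sT (pT &0)))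
/-- (B2) `∀x∀y x + y = y + x`. -/
def axB2 : LTri.Sentence := ∀' ∀' (aT &0 &1 =' aT &1 &0)
/-- (B3) `∀x∀y∀z (x+y)+z = x+(y+z)`. -/
def axB3 : LTri.Sentence := ∀' ∀' ∀' (aT (aT &0 &1) &2 =' aT &0 (aT &1 &2))
/-- (B4) `∀x∀y∀z (x+y = x+z → y = z)`. -/
def axB4 : LTri.Sentence := ∀' ∀' ∀' ((aT &0 &1 =' aT &0 &2) ⟹ (&1 =' &2))

/-- The theory `T_▷^I = T_▷ + B1 + B2 + B3 + B4`. -/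
def TTriI : LTri.Theory := TTri ∪ {axB1, axB2, axB3, axB4}

end TriangularNumbers

namespace TriangularNumbers

/-- Simple terms: terms of `L_▷` not containing the symbol `p`. -/
inductive TermSimple {α : Type u'} : LTri.Term α → Prop
  | var (x : α) : TermSimple (Term.var x)
  | zero : TermSimple zT
  | succ {t : LTri.Term α} : TermSimple t → TermSimple (sT t)
  | plus {t u : LTri.Term α} : TermSimple t → TermSimple u → TermSimple (aT t u)

/-- Simple formulas: formulas of `L_▷` not containing the symbol `p`. -/
inductive FormulaSimple {α : Type u'} : ∀ {n : ℕ}, LTri.BoundedFormula α n → Prop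
  | falsum {n : ℕ} : FormulaSimple (BoundedFormula.falsum (n := n))
  | equal {n : ℕ} {t₁ t₂ : LTri.Term (α ⊕ Fin n)} :
      TermSimple t₁ → TermSimple t₂ → FormulaSimple (t₁.bdEqual t₂)
  | rel {n l : ℕ} {R : LTri.Relations l} {ts : Fin l → LTri.Term (α ⊕ Fin n)} :
      (∀ i, TermSimple (ts i)) → FormulaSimple (R.boundedFormula ts)
  | imp {n : ℕ} {φ ψ : LTri.BoundedFormula α n} :
      FormulaSimple φ → FormulaSimple ψ → FormulaSimple (φ.imp ψ)
  | all {n : ℕ} {φ : LTri.BoundedFormula α (n + 1)} : FormulaSimple φ → FormulaSimple φ.all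

end TriangularNumbers

namespace TriangularNumbers

variable {M : Type u} [LTri.Structure M]

/-- The interpretation `0` of the symbol `0` in a model. -/
def zM (M : Type u) [LTri.Structure M] : M := funMap fZero ![]
/-- The interpretation `S` of the symbol `s` in a model. -/
def sM (a : M) : M := funMap fSucc ![a]
/-- The interpretation `P` of the symbol `p` in a model. -/
def pM (a : M) : M := funMap fPred ![a]
/-- The interpretation `+` of the symbol `+` in a model. -/
def addM (a b : M) : M := funMap fPlus ![a, b]

/-- An element is standard if it is of the form `S^m(0)` for some `m ∈ ℕ`,
and non-standard otherwise. -/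
def IsStd (a : M) : Prop := ∃ m : ℕ, a = sM^[m] (zM M)

end TriangularNumbers

namespace TriangularNumbers

variable {M : Type u} [LTri.Structure M]

/-- `a ≺ b`: there is `n ≥ 1` with `S^n(a) = b`. -/
def Prec (a b : M) : Prop := ∃ n : ℕ, 1 ≤ n ∧ sM^[n] a = b

/-- `a ⪯ b`: `a ≺ b` or `a = b`. -/
def PrecEq (a b : M) : Prop := Prec a b ∨ a = b

/-- `a` and `b` are comparable: `a ⪯ b` or `b ⪯ a`. -/
def Cmp (a b : M) : Prop := PrecEq a b ∨ PrecEq b a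

section Affine

variable {G : Type*} [AddCancelCommMonoid G] {e : G}

theorem tri_add_nsmul {T : G → G → Prop} (hT : ∀ x y, T x y → T (x + e) ((x + e) + y))
    {x y : G} (h : T x y) (j : ℕ) :
    T (x + j • e) (y + j • x + (∑ i ∈ Finset.range (j + 1), i) • e) := by
  induction j with
  | zero => simpa using h
  | succ j ih =>
    have := hT _ _ ih
    rw [Finset.sum_range_succ]
    convert this using 1
    · rw [succ_nsmul, add_assoc]
    · simp only [add_nsmul, one_nsmul]
      abel

theorem affine_eq_of_two (he : Function.Injective fun n : ℕ => n • e) {n m : ℕ} {c d a : G}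
    {i : ℕ} (hi : 0 < i) (h₀ : n • a + c = m • a + d)
    (h₁ : n • (a + i • e) + c = m • (a + i • e) + d) : n = m ∧ c = d := by
  have key : (n * i) • e = (m * i) • e := by
    apply add_right_cancel (b := n • a + c)
    nth_rewrite 2 [h₀]
    simp only [mul_nsmul', nsmul_add] at h₁ ⊢
    convert h₁ using 1 <;> abel
  have hnm : n = m := Nat.eq_of_mul_eq_mul_right hi (he key)
  subst hnm
  exact ⟨rfl, add_left_cancel h₀⟩

theorem affine_tri_of_three (he : Function.Injective fun n : ℕ => n • e) {T : G → G → Prop}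
    (hT : ∀ x y, T x y → T (x + e) ((x + e) + y)) (hU : ∀ x y z, T x y → T x z → y = z)
    {n m : ℕ} {c d a : G} {i j : ℕ} (hi : 0 < i) (hj : 0 < j) (hij : i ≠ j)
    (h₀ : T (n • a + c) (m • a + d))
    (h₁ : T (n • (a + i • e) + c) (m • (a + i • e) + d))
    (h₂ : T (n • (a + j • e) + c) (m • (a + j • e) + d)) : n = 0 ∧ m = 0 := by
  have step : ∀ k : ℕ, T (n • (a + k • e) + c) (m • (a + k • e) + d) →
      (m * k) • e = (n * k) • (n • a + c) + (∑ i ∈ Finset.range (n * k + 1), i) • e := by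
    intro k hk
    have h := tri_add_nsmul hT h₀ (n * k)
    have hx : n • (a + k • e) + c = n • a + c + (n * k) • e := by
      rw [mul_nsmul', nsmul_add]; abel
    rw [hx] at hk
    have hy := hU _ _ _ hk h
    apply add_left_cancel (a := m • a + d)
    rw [← add_assoc, ← hy, mul_nsmul', nsmul_add]
    abel
  have hi' := step i h₁
  have hj' := step j h₂
  generalize n • a + c = X at hi' hj'
  have hsum : (j * ∑ l ∈ Finset.range (n * i + 1), l) = i * ∑ l ∈ Finset.range (n * j + 1), l := by
    apply he
    beta_reduce
    apply add_left_cancel (a := (n * i * j) • X)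
    have e₁ := congrArg (fun x => j • x) hi'
    have e₂ := congrArg (fun x => i • x) hj'
    simp only [nsmul_add, ← mul_nsmul'] at e₁ e₂
    rw [show j * (m * i) = i * (m * j) by ring, e₂] at e₁
    rw [show i * (n * j) = n * i * j by ring, show j * (n * i) = n * i * j by ring] at e₁
    exact e₁.symm
  have gauss : ∀ k : ℕ, (∑ l ∈ Finset.range (k + 1), l) * 2 = (k + 1) * k := fun k => by
    simpa using Finset.sum_range_id_mul_two (k + 1)
  have hn : n = 0 := by
    by_contra hn
    have h : j * ((n * i + 1) * (n * i)) = i * ((n * j + 1) * (n * j)) := by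
      rw [← gauss, ← gauss, ← mul_assoc, ← mul_assoc, hsum]
    have h' : (n * i * j) * (n * i + 1) = (n * i * j) * (n * j + 1) := by
      linear_combination h
    have hpos : 0 < n * i * j := by positivity
    have h'' := Nat.eq_of_mul_eq_mul_left hpos h'
    exact hij (Nat.eq_of_mul_eq_mul_left (Nat.pos_of_ne_zero hn) (by omega))
  subst hn
  refine ⟨rfl, ?_⟩
  have h0 : (m * i) • e = 0 • e := by simpa using hi'
  have := he h0
  rcases Nat.mul_eq_zero.1 this with h | h
  · exact h
  · omega

end Affine

section Model

variable {M : Type u} [LTri.Structure M]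

theorem Cmp.exists_iterate {x y : M} (h : Cmp x y) :
    (∃ n, sM^[n] x = y) ∨ ∃ n, sM^[n] y = x := by
  rcases h with (⟨n, -, h⟩ | h) | (⟨n, -, h⟩ | h)
  · exact .inl ⟨n, h⟩
  · exact .inl ⟨0, h⟩
  · exact .inr ⟨n, h⟩
  · exact .inr ⟨0, h⟩

theorem exists_least_of_three {x y z : M} (hxy : Cmp x y) (hxz : Cmp x z) (hyz : Cmp y z)
    (nxy : x ≠ y) (nxz : x ≠ z) (nyz : y ≠ z) {P : M → Prop} (hx : P x) (hy : P y) (hz : P z) :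
    ∃ a i j, 0 < i ∧ 0 < j ∧ i ≠ j ∧ P a ∧ P (sM^[i] a) ∧ P (sM^[j] a) := by
  have build : ∀ {a u v : M}, (∃ i, sM^[i] a = u) → (∃ j, sM^[j] a = v) → a ≠ u → a ≠ v → u ≠ v →
      P a → P u → P v →
      ∃ a i j, 0 < i ∧ 0 < j ∧ i ≠ j ∧ P a ∧ P (sM^[i] a) ∧ P (sM^[j] a) := by
    rintro a u v ⟨i, rfl⟩ ⟨j, rfl⟩ hu hv huv ha hi hj
    refine ⟨a, i, j, Nat.pos_of_ne_zero ?_, Nat.pos_of_ne_zero ?_, ?_, ha, hi, hj⟩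
    · rintro rfl; exact hu rfl
    · rintro rfl; exact hv rfl
    · rintro rfl; exact huv rfl
  have trans : ∀ {a u v : M}, (∃ i, sM^[i] a = u) → (∃ j, sM^[j] u = v) → ∃ k, sM^[k] a = v := by
    rintro a u v ⟨i, rfl⟩ ⟨j, rfl⟩
    exact ⟨j + i, Function.iterate_add_apply _ _ _ _⟩
  rcases hxy.exists_iterate with h₁ | h₁ <;> rcases hxz.exists_iterate with h₂ | h₂ <;>
    rcases hyz.exists_iterate with h₃ | h₃
  · exact build h₁ h₂ nxy nxz nyz hx hy hz
  · exact build h₁ h₂ nxy nxz nyz hx hy hz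
  · exact build h₂ (trans h₂ h₁) nxz.symm nyz.symm nxy hz hx hy
  · exact build h₂ (trans h₂ h₁) nxz.symm nyz.symm nxy hz hx hy
  · exact build h₁ h₃ nxy.symm nyz nxz hy hx hz
  · exact build (trans h₁ h₂) h₁ nyz nxy.symm nxz.symm hy hz hx
  · exact build h₁ h₃ nxy.symm nyz nxz hy hx hz
  · exact build h₂ h₃ nxz.symm nyz.symm nxy hz hx hy

open scoped Classical in
theorem forall_or_finite_of_three {P : M → Prop}
    (h : ∀ a i j, 0 < i → 0 < j → i ≠ j → P a → P (sM^[i] a) → P (sM^[j] a) → ∀ x, P x) :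
    (∀ x, P x) ∨ ∀ A : Set M, (∀ x ∈ A, P x) → A.Pairwise Cmp → A.Finite := by
  by_contra! hcon
  obtain ⟨⟨w, hw⟩, A, hP, hC, hA⟩ := hcon
  obtain ⟨t, htA, ht⟩ := Set.Infinite.exists_subset_card_eq hA 3
  obtain ⟨x, y, z, nxy, nxz, nyz, rfl⟩ := Finset.card_eq_three.1 ht
  have hx : x ∈ A := htA (by simp)
  have hy : y ∈ A := htA (by simp)
  have hz : z ∈ A := htA (by simp)
  obtain ⟨a, i, j, hi, hj, hij, ha, hai, haj⟩ := exists_least_of_three (hC hx hy nxy)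
    (hC hx hz nxz) (hC hy hz nyz) nxy nxz nyz (hP x hx) (hP y hy) (hP z hz)
  exact hw (h a i j hi hj hij ha hai haj w)

/-- The interpretation of `▷` in a model. -/
def triM (a b : M) : Prop := RelMap rTri ![a, b]

theorem realize_zT {α : Type*} (v : α → M) : (zT : LTri.Term α).realize v = zM M := by
  simp only [zT, Term.realize_constants, constantMap, zM]
  congr 1

theorem realize_sT {α : Type*} (v : α → M) (t : LTri.Term α) :
    (sT t).realize v = sM (t.realize v) := by
  simp [sT, sM, Term.realize_functions_apply₁]

theorem realize_pT {α : Type*} (v : α → M) (t : LTri.Term α) :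
    (pT t).realize v = pM (t.realize v) := by
  simp [pT, pM, Term.realize_functions_apply₁]

theorem realize_aT {α : Type*} (v : α → M) (t u : LTri.Term α) :
    (aT t u).realize v = addM (t.realize v) (u.realize v) := by
  simp [aT, addM, Term.realize_functions_apply₂]

theorem realize_boundedFormula_rTri {α : Type*} {n : ℕ} (v : α → M) (w : Fin n → M)
    (ts : Fin 2 → LTri.Term (α ⊕ Fin n)) :
    (Relations.boundedFormula rTri ts).Realize v w ↔
      triM ((ts 0).realize (Sum.elim v w)) ((ts 1).realize (Sum.elim v w)) := by
  rw [BoundedFormula.realize_rel, triM]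
  exact iff_of_eq (congrArg _ (funext fun q => by fin_cases q <;> rfl))

theorem realize_rTri {α : Type*} {n : ℕ} (v : α → M) (w : Fin n → M)
    (t u : LTri.Term (α ⊕ Fin n)) :
    (rTri.boundedFormula₂ t u).Realize v w ↔
      triM (t.realize (Sum.elim v w)) (u.realize (Sum.elim v w)) :=
  realize_boundedFormula_rTri v w ![t, u]

theorem realize_of_mem (hM : M ⊨ TTriI) {σ : LTri.Sentence} (h : σ ∈ TTriI) : M ⊨ σ :=
  Theory.realize_sentence_of_mem (T := TTriI) h

theorem sM_ne_zM (hM : M ⊨ TTriI) (x : M) : sM x ≠ zM M := by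
  have h := realize_of_mem hM (σ := axA1) (by simp [TTriI, TTri])
  have h := h x
  simpa [axA1, realize_zT, realize_sT, Fin.snoc] using h

theorem pM_sM (hM : M ⊨ TTriI) (x : M) : pM (sM x) = x := by
  have h := realize_of_mem hM (σ := axA3) (by simp [TTriI, TTri])
  simpa [axA3, realize_pT, realize_sT, Fin.snoc] using h x

theorem addM_zM (hM : M ⊨ TTriI) (x : M) : addM x (zM M) = x := by
  have h := realize_of_mem hM (σ := axA4) (by simp [TTriI, TTri])
  simpa [axA4, realize_zT, realize_aT, Fin.snoc] using h x

theorem addM_sM (hM : M ⊨ TTriI) (x y : M) : addM x (sM y) = sM (addM x y) := by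
  have h := realize_of_mem hM (σ := axA5) (by simp [TTriI, TTri])
  simpa [axA5, realize_sT, realize_aT, Fin.snoc] using h x y

theorem triM_sM (hM : M ⊨ TTriI) {x y : M} (hxy : triM x y) :
    triM (sM x) (addM (sM x) y) := by
  have h := realize_of_mem hM (σ := axA7) (by simp [TTriI, TTri])
  simp only [axA7, Sentence.Realize, Formula.Realize, BoundedFormula.realize_all,
    BoundedFormula.realize_imp, realize_rTri] at h
  simpa [realize_sT, realize_aT, Fin.snoc] using h x y (by simpa [Fin.snoc] using hxy)

theorem triM_unique (hM : M ⊨ TTriI) {x y z : M} (hy : triM x y) (hz : triM x z) : y = z := by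
  have h := realize_of_mem hM (σ := axA9) (by simp [TTriI, TTri])
  simp only [axA9, Sentence.Realize, Formula.Realize, BoundedFormula.realize_all,
    BoundedFormula.realize_imp, BoundedFormula.realize_inf, realize_rTri] at h
  simpa [Fin.snoc] using h x y z (by simpa [Fin.snoc] using ⟨hy, hz⟩)

theorem addM_comm (hM : M ⊨ TTriI) (x y : M) : addM x y = addM y x := by
  have h := realize_of_mem hM (σ := axB2) (by simp [TTriI])
  simpa [axB2, realize_aT, Fin.snoc] using h x y

theorem addM_assoc (hM : M ⊨ TTriI) (x y z : M) :
    addM (addM x y) z = addM x (addM y z) := by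
  have h := realize_of_mem hM (σ := axB3) (by simp [TTriI])
  simpa [axB3, realize_aT, Fin.snoc] using h x y z

theorem addM_left_cancel (hM : M ⊨ TTriI) (x y z : M) (hxyz : addM x y = addM x z) :
    y = z := by
  have h := realize_of_mem hM (σ := axB4) (by simp [TTriI])
  simp only [axB4, Sentence.Realize, Formula.Realize, BoundedFormula.realize_all,
    BoundedFormula.realize_imp, BoundedFormula.realize_bdEqual] at h
  simpa [realize_aT, Fin.snoc] using
    h x y z (by simpa [realize_aT, Fin.snoc] using hxyz)

/-- A model of `T_▷^I` is a cancellative commutative monoid under `+`. -/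
abbrev addCancelCommMonoidOfModel (hM : M ⊨ TTriI) : AddCancelCommMonoid M where
  add := addM
  zero := zM M
  nsmul := @nsmulRec M ⟨zM M⟩ ⟨addM⟩
  add_assoc := addM_assoc hM
  add_comm := addM_comm hM
  zero_add x := (addM_comm hM _ _).trans (addM_zM hM x)
  add_zero := addM_zM hM
  add_left_cancel x y z := addM_left_cancel hM x y z

theorem sM_iterate_injective (hM : M ⊨ TTriI) :
    Function.Injective fun n : ℕ => sM^[n] (zM M) := by
  have hs : Function.Injective (sM : M → M) := Function.LeftInverse.injective (pM_sM hM)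
  intro n
  induction n with
  | zero =>
    rintro (_ | m) h
    · rfl
    · simp only [Function.iterate_zero, id, Function.iterate_succ_apply'] at h
      exact absurd h.symm (sM_ne_zM hM _)
  | succ n ih =>
    rintro (_ | m) h
    · simp only [Function.iterate_zero, id, Function.iterate_succ_apply'] at h
      exact absurd h (sM_ne_zM hM _)
    · simp only [Function.iterate_succ_apply'] at h
      rw [ih (hs h)]

theorem TermSimple.exists_affine (hM : M ⊨ TTriI) {α : Type*} {w : M → α → M} :
    letI := addCancelCommMonoidOfModel hM
    (∀ i, ∃ (n : ℕ) (c : M), ∀ a, w a i = n • a + c) → ∀ {t : LTri.Term α}, TermSimple t →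
      ∃ (n : ℕ) (c : M), ∀ a, t.realize (w a) = n • a + c := by
  let _ := addCancelCommMonoidOfModel hM
  intro hw t ht
  have hadd : ∀ x y : M, addM x y = x + y := fun _ _ => rfl
  have hzero : zM M = 0 := rfl
  induction ht with
  | var i => simpa using hw i
  | zero => exact ⟨0, 0, fun a => by simp [realize_zT, hzero]⟩
  | succ _ ih =>
    obtain ⟨n, c, h⟩ := ih
    exact ⟨n, sM c, fun a => by rw [realize_sT, h, ← hadd, ← hadd, addM_sM hM]⟩
  | plus _ _ ih₁ ih₂ =>
    obtain ⟨n, c, h⟩ := ih₁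
    obtain ⟨m, d, h'⟩ := ih₂
    exact ⟨n + m, c + d, fun a => by rw [realize_aT, h, h', hadd, add_nsmul]; abel⟩

theorem exists_affine_realize_rel (hM : M ⊨ TTriI) {α : Type*} {w : M → α → M} {l k : ℕ}
    {v : M → Fin k → M} :
    letI := addCancelCommMonoidOfModel hM
    (∀ i, ∃ (n : ℕ) (c : M), ∀ a, Sum.elim (w a) (v a) i = n • a + c) →
      ∀ (R : LTri.Relations l) {ts : Fin l → LTri.Term (α ⊕ Fin k)}, (∀ i, TermSimple (ts i)) →
      ∃ (n : ℕ) (c : M) (m : ℕ) (d : M), ∀ a,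
        (R.boundedFormula ts).Realize (w a) (v a) ↔ triM (n • a + c) (m • a + d) := by
  let _ := addCancelCommMonoidOfModel hM
  intro hw R ts hts
  obtain _ | _ := R
  obtain ⟨n, c, hc⟩ := (hts 0).exists_affine hM hw
  obtain ⟨m, d, hd⟩ := (hts 1).exists_affine hM hw
  refine ⟨n, c, m, d, fun a => ?_⟩
  rw [← hc, ← hd]
  exact realize_boundedFormula_rTri (w a) (v a) ts

end Model

/-- Let `M` be a model of `T_▷^I`, let `φ(x,ȳ)` be a simple atomic
`L_▷`-formula, and let `b̄` be a tuple of elements of `M`. Then either `φ(a,b̄)` holds in `M`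
for every `a ∈ M`, or every set of pairwise comparable solutions of `φ(x,b̄)` in `M` is
finite. -/
theorem statement10 (M : Type u) [LTri.Structure M] [Nonempty M] (hM : M ⊨ TTriI)
    {k : ℕ} (φ : LTri.Formula (Fin 1 ⊕ Fin k)) (hat : φ.IsAtomic) (hsimple : FormulaSimple φ)
    (b : Fin k → M) :
    (∀ a : M, φ.Realize (Sum.elim (fun _ => a) b)) ∨
      ∀ A : Set M, (∀ x ∈ A, φ.Realize (Sum.elim (fun _ => x) b)) →
        A.Pairwise Cmp → A.Finite := by
  let _ := addCancelCommMonoidOfModel hM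
  have hsucc : ∀ x : M, sM x = x + sM (zM M) := fun x => by
    change sM x = addM x (sM (zM M))
    rw [addM_sM hM, addM_zM hM]
  have hiter : ∀ (n : ℕ) (x : M), sM^[n] x = x + n • sM (zM M) := by
    intro n x
    induction n with
    | zero => simp
    | succ n ih => rw [Function.iterate_succ_apply', ih, hsucc, succ_nsmul, add_assoc]
  have he : Function.Injective fun n : ℕ => n • sM (zM M) := by
    intro n m h
    refine sM_iterate_injective hM ?_
    simp only [hiter] at h ⊢
    rw [h]
  have hw : ∀ i : (Fin 1 ⊕ Fin k) ⊕ Fin 0, ∃ (n : ℕ) (c : M), ∀ a : M,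
      Sum.elim (Sum.elim (fun _ => a) b) default i = n • a + c := by
    rintro ((i | i) | i)
    · exact ⟨1, 0, fun a => by simp⟩
    · exact ⟨0, b i, fun a => by simp⟩
    · exact i.elim0
  apply forall_or_finite_of_three
  intro a i j hi hj hij h₀ h₁ h₂ x
  rw [hiter] at h₁ h₂
  cases hsimple with
  | falsum => exact h₀.elim
  | imp _ _ => cases hat
  | all _ => cases hat
  | @equal _ t₁ t₂ ht₁ ht₂ =>
    obtain ⟨n, c, hc⟩ := ht₁.exists_affine hM hw
    obtain ⟨m, d, hd⟩ := ht₂.exists_affine hM hw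
    simp only [Formula.Realize, BoundedFormula.realize_bdEqual, hc, hd] at h₀ h₁ ⊢
    obtain ⟨rfl, rfl⟩ := affine_eq_of_two he hi h₀ h₁
    rfl
  | @rel _ l R ts hts =>
    obtain ⟨n, c, m, d, key⟩ := exists_affine_realize_rel hM hw R hts
    have h₀ := (key _).1 h₀
    have h₁ := (key _).1 h₁
    have h₂ := (key _).1 h₂
    have hT : ∀ x y : M, triM x y → triM (x + sM (zM M)) ((x + sM (zM M)) + y) := fun x y h => by
      rw [← hsucc x]
      exact triM_sM hM h
    obtain ⟨rfl, rfl⟩ := affine_tri_of_three (n := n) (m := m) (a := a) (c := c) (d := d) he hT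
      (fun x y z hy hz => triM_unique hM hy hz) hi hj hij h₀ h₁ h₂
    refine (key x).2 ?_
    simpa only [zero_nsmul] using h₀

end TriangularNumbers
end

section
/- Every model of T_▷^I is a model of IOpen(L_▷); that is, every L_▷-structure satisfying the axioms A1–A9 and B1–B4 satisfies the induction axiom Ind_x θ for every quantifier-free L_▷-formula θ(x,z̄). -/
open FirstOrder Language Structure

universe u v u'

namespace TriangularNumbers

/-- Universal quantification of the distinguished (`Sum.inr`) free variable. -/
def close1 {L : FirstOrder.Language.{u, v}} {α : Type u'} (φ : L.Formula (α ⊕ Fin 1)) :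
    L.Formula α :=
  (BoundedFormula.relabel (Sum.elim Sum.inl (fun _ => Sum.inr (0 : Fin 1))) φ).all

/-- Universal closure of a formula with finitely many free variables. -/
def closeAll {L : FirstOrder.Language.{u, v}} {k : ℕ} (φ : L.Formula (Fin k)) : L.Sentence :=
  (BoundedFormula.relabel (fun i => (Sum.inr i : Empty ⊕ Fin k)) φ).alls

/-- The induction axiom `Ind_x ψ` for a formula `ψ(x, z̄)`, where the induction variable `x`
is the `Sum.inr` variable and the parameters `z̄` are the `Sum.inl` variables:
`∀ z̄ (ψ(0,z̄) → ∀x (ψ(x,z̄) → ψ(s(x),z̄)) → ∀x ψ(x,z̄))`. -/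
def indAxiom {L : FirstOrder.Language.{u, v}} (zero : L.Constants) (succ : L.Functions 1)
    {k : ℕ} (ψ : L.Formula (Fin k ⊕ Fin 1)) : L.Sentence :=
  closeAll
    ((ψ.subst (Sum.elim Term.var fun _ => Constants.term zero)).imp
      ((close1 (ψ.imp
          (ψ.subst (Sum.elim (fun i => Term.var (Sum.inl i))
            fun _ => Functions.apply₁ succ (Term.var (Sum.inr 0)))))).imp
        (close1 ψ)))

/-- The theory `IOpen(L)` of induction for quantifier-free formulas. -/
def IOpenTh {L : FirstOrder.Language.{u, v}} (zero : L.Constants) (succ : L.Functions 1) :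
    L.Theory :=
  { σ | ∃ (k : ℕ) (ψ : L.Formula (Fin k ⊕ Fin 1)), ψ.IsQF ∧ σ = indAxiom zero succ ψ }

end TriangularNumbers

namespace TriangularNumbers

open Filter

section Monoid

variable {M : Type*} [AddCancelCommMonoid M]

/-- A filter `F` is sparse along `e` if it contains the complement of every set in which no three
distinct points differ by multiples of `e`. -/
def SparseAlong (e : M) (F : Filter M) : Prop :=
  ∀ Q : M → Prop, (∀ x k l, 0 < k → 0 < l → Q x → Q (x + k • e) → Q (x + (k + l) • e) → False) →
    ∀ᶠ x in F, ¬ Q x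

theorem SparseAlong.map_ascending {e : M} {g : ℕ → M} (hg : ∀ n k, g (n + k) = g n + k • e) :
    SparseAlong e (map g atTop) := by
  intro Q hQ
  by_contra h
  have h' : ∃ᶠ n in atTop, Q (g n) := by simpa [Filter.Frequently] using h
  rw [frequently_atTop'] at h'
  obtain ⟨i, -, hi⟩ := h' 0
  obtain ⟨j, hij, hj⟩ := h' i
  obtain ⟨m, hjm, hm⟩ := h' j
  refine hQ (g i) (j - i) (m - j) (by omega) (by omega) hi ?_ ?_
  · rw [← hg]; convert hj using 2; omega
  · rw [← hg]; convert hm using 2; omega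

theorem SparseAlong.map_descending {e : M} {g : ℕ → M} (hg : ∀ n k, g n = g (n + k) + k • e) :
    SparseAlong e (map g atTop) := by
  intro Q hQ
  by_contra h
  have h' : ∃ᶠ n in atTop, Q (g n) := by simpa [Filter.Frequently] using h
  rw [frequently_atTop'] at h'
  obtain ⟨i, -, hi⟩ := h' 0
  obtain ⟨j, hij, hj⟩ := h' i
  obtain ⟨m, hjm, hm⟩ := h' j
  refine hQ (g m) (m - j) (j - i) (by omega) (by omega) hm ?_ ?_
  · have := hg j (m - j)
    rw [show j + (m - j) = m by omega] at this
    rwa [← this]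
  · have := hg i (m - j + (j - i))
    rw [show i + (m - j + (j - i)) = m by omega] at this
    rwa [← this]

theorem SparseAlong.sup {e : M} {F G : Filter M} (hF : SparseAlong e F) (hG : SparseAlong e G) :
    SparseAlong e (F ⊔ G) :=
  fun Q hQ => eventually_sup.2 ⟨hF Q hQ, hG Q hQ⟩

/-- `f` is eventually of the form `x ↦ m • x + a - b`. -/
def EventuallyAffine (F : Filter M) (m : ℕ) (f : M → M) : Prop :=
  ∃ a b : M, ∀ᶠ x in F, f x + b = m • x + a

variable {F : Filter M} {f g : M → M} {m m' : ℕ}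

theorem EventuallyAffine.const (d : M) : EventuallyAffine F 0 fun _ => d :=
  ⟨d, 0, by simp⟩

theorem EventuallyAffine.id : EventuallyAffine F 1 fun x => x :=
  ⟨0, 0, by simp⟩

theorem EventuallyAffine.congr (hf : EventuallyAffine F m f) (h : ∀ x, f x = g x) :
    EventuallyAffine F m g := by
  rwa [← funext h]

theorem EventuallyAffine.add (hf : EventuallyAffine F m f) (hg : EventuallyAffine F m' g) :
    EventuallyAffine F (m + m') fun x => f x + g x := by
  obtain ⟨a, b, h⟩ := hf
  obtain ⟨a', b', h'⟩ := hg
  refine ⟨a + a', b + b', ?_⟩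
  filter_upwards [h, h'] with x hx hx'
  rw [add_add_add_comm, hx, hx', add_nsmul, add_add_add_comm]

theorem EventuallyAffine.exists_eventually_eq [F.NeBot] (hf : EventuallyAffine F 0 f) :
    ∃ d, ∀ᶠ x in F, f x = d := by
  obtain ⟨a, b, h⟩ := hf
  obtain ⟨y, hy⟩ := h.exists
  refine ⟨f y, ?_⟩
  filter_upwards [h] with x hx
  exact add_right_cancel (b := b) (by rw [hx, hy, zero_nsmul, zero_nsmul])

variable {e : M}

theorem SparseAlong.eventually_ne_of_lt (hF : SparseAlong e F)
    (he : Function.Injective fun n : ℕ => n • e) (hf : EventuallyAffine F m f)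
    (hg : EventuallyAffine F m' g) (hm : m < m') : ∀ᶠ x in F, f x ≠ g x := by
  obtain ⟨a, b, h⟩ := hf
  obtain ⟨a', b', h'⟩ := hg
  obtain ⟨d, rfl⟩ := Nat.exists_eq_add_of_lt hm
  have key := hF (fun x => a + b' = (d + 1) • x + (a' + b)) fun x k l hk hl h1 h2 _ => by
    rw [h1, nsmul_add, add_right_cancel_iff] at h2
    rw [left_eq_add, ← mul_nsmul'] at h2
    have : (d + 1) * k = 0 := he (by simpa using h2)
    simp at this
    omega
  filter_upwards [h, h', key] with x hx hx' hk heq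
  refine hk (add_left_cancel (a := m • x) ?_)
  calc m • x + (a + b') = f x + b + b' := by rw [hx]; abel
    _ = (g x + b') + b := by rw [heq]; abel
    _ = _ := by rw [hx', add_assoc m, add_nsmul]; abel

theorem SparseAlong.eventually_ne (hF : SparseAlong e F)
    (he : Function.Injective fun n : ℕ => n • e) (hf : EventuallyAffine F m f)
    (hg : EventuallyAffine F m' g) (hm : m ≠ m') : ∀ᶠ x in F, f x ≠ g x := by
  rcases hm.lt_or_gt with h | h
  · exact hF.eventually_ne_of_lt he hf hg h
  · exact (hF.eventually_ne_of_lt he hg hf h).mono fun _ => Ne.symm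

theorem SparseAlong.eventually_eq_or_ne [F.NeBot] (hF : SparseAlong e F)
    (he : Function.Injective fun n : ℕ => n • e) (hf : EventuallyAffine F m f)
    (hg : EventuallyAffine F m' g) : (∀ᶠ x in F, f x = g x) ∨ ∀ᶠ x in F, f x ≠ g x := by
  by_cases hm : m = m'
  · subst hm
    obtain ⟨a, b, h⟩ := hf
    obtain ⟨a', b', h'⟩ := hg
    have key : ∀ᶠ x in F, f x = g x ↔ a + b' = a' + b := by
      filter_upwards [h, h'] with x hx hx'
      have e1 : f x + (b + b') = m • x + (a + b') := by rw [← add_assoc, hx, add_assoc]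
      have e2 : g x + (b + b') = m • x + (a' + b) := by
        rw [add_comm b, ← add_assoc, hx', add_assoc]
      rw [← add_right_cancel_iff (a := b + b'), e1, e2, add_left_cancel_iff]
    by_cases hab : a + b' = a' + b
    · exact .inl (key.mono fun x hx => hx.2 hab)
    · exact .inr (key.mono fun x hx => mt hx.1 hab)
  · exact .inr (hF.eventually_ne he hf hg hm)

theorem EventuallyAffine.exists_pred [F.NeBot] (hF : SparseAlong e F)
    (he : Function.Injective fun n : ℕ => n • e) (hf : EventuallyAffine F m f) {p : M → M}
    (hp : ∀ x, x ≠ 0 → x = p x + e) : EventuallyAffine F m fun x => p (f x) := by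
  rcases Nat.eq_zero_or_pos m with rfl | hm
  · obtain ⟨d, hd⟩ := hf.exists_eventually_eq
    refine ⟨p d, 0, ?_⟩
    filter_upwards [hd] with x hx
    simp [hx]
  · have hne := hF.eventually_ne he hf (.const 0) hm.ne'
    obtain ⟨a, b, h⟩ := hf
    refine ⟨a, e + b, ?_⟩
    filter_upwards [h, hne] with x hx hx0
    rw [← hx, ← add_assoc, ← hp _ hx0]

theorem triangular_iterate {R : M → M → Prop}
    (hR : ∀ x y, R x y → R (x + e) (x + e + y)) {x y : M} (h : R x y) (j : ℕ) :
    R (x + j • e) (y + j • x + (∑ i ∈ Finset.range (j + 1), i) • e) := by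
  induction j with
  | zero => simpa using h
  | succ j ih =>
    have := hR _ _ ih
    convert this using 1
    · rw [succ_nsmul, add_assoc]
    · rw [Finset.sum_range_succ _ (j + 1)]
      simp only [add_nsmul, one_nsmul]
      abel

theorem SparseAlong.eventually_not_rel (hF : SparseAlong e F)
    (he : Function.Injective fun n : ℕ => n • e) {R : M → M → Prop}
    (hR : ∀ x y, R x y → R (x + e) (x + e + y)) (hfun : ∀ x y z, R x y → R x z → y = z)
    (hf : EventuallyAffine F m f) (hg : EventuallyAffine F m' g) (hm : m ≠ 0) :
    ∀ᶠ x in F, ¬ R (f x) (g x) := by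
  obtain ⟨a, b, h⟩ := hf
  obtain ⟨a', b', h'⟩ := hg
  have shift : ∀ {u : M → M} {r : ℕ} {c d x : M} {k : ℕ}, u x + d = r • x + c →
      u (x + k • e) + d = r • (x + k • e) + c → u (x + k • e) = u x + (r * k) • e := by
    intro u r c d x k h1 h2
    apply add_right_cancel (b := d)
    rw [h2, nsmul_add, ← mul_nsmul', add_right_comm (u x), h1]
    abel
  have slope : ∀ {x : M} {k : ℕ},
      (f x + b = m • x + a ∧ g x + b' = m' • x + a') ∧ R (f x) (g x) →
      (f (x + k • e) + b = m • (x + k • e) + a ∧ g (x + k • e) + b' = m' • (x + k • e) + a') ∧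
        R (f (x + k • e)) (g (x + k • e)) →
      (m' * k) • e = (m * k) • f x + (∑ i ∈ Finset.range (m * k + 1), i) • e := by
    rintro x k ⟨⟨h1, h2⟩, h3⟩ ⟨⟨h4, h5⟩, h6⟩
    rw [shift h1 h4, shift h2 h5] at h6
    have := hfun _ _ _ h6 (triangular_iterate hR h3 (m * k))
    rw [add_assoc] at this
    exact add_left_cancel this
  have key := hF (fun x => (f x + b = m • x + a ∧ g x + b' = m' • x + a') ∧ R (f x) (g x))
    fun x k l hk hl h1 h2 h3 => by
      have e1 := slope h1 h2
      rw [add_nsmul, ← add_assoc] at h3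
      have e2 := slope h2 h3
      rw [shift h1.1.1 h2.1.1] at e2
      have e3 := congrArg (l • ·) e1
      have e4 := congrArg (k • ·) e2
      simp only [nsmul_add, ← mul_nsmul'] at e3 e4
      rw [show k * (m' * l) = l * (m' * k) by ring, e3,
        show k * (m * l) = l * (m * k) by ring, add_assoc, add_left_cancel_iff, ← add_nsmul] at e4
      have e5 := he e4
      have s1 := Finset.sum_range_id_mul_two (m * k + 1)
      have s2 := Finset.sum_range_id_mul_two (m * l + 1)
      simp only [Nat.add_sub_cancel] at s1 s2
      have hm' : 0 < m := Nat.pos_of_ne_zero hm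
      have e6 : l * ((m * k + 1) * (m * k)) =
          2 * (l * (m * k) * (m * k)) + k * ((m * l + 1) * (m * l)) := by
        rw [← s1, ← s2]
        linear_combination 2 * e5
      have : 0 < k * l * m * (m * k + m * l) := by positivity
      nlinarith
  filter_upwards [h, h', key] with x hx hx' hk hr
  exact hk ⟨⟨hx, hx'⟩, hr⟩

theorem SparseAlong.eventually_rel_or_not_rel [F.NeBot] (hF : SparseAlong e F)
    (he : Function.Injective fun n : ℕ => n • e) {R : M → M → Prop}
    (hR : ∀ x y, R x y → R (x + e) (x + e + y)) (hfun : ∀ x y z, R x y → R x z → y = z)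
    (hf : EventuallyAffine F m f) (hg : EventuallyAffine F m' g) :
    (∀ᶠ x in F, R (f x) (g x)) ∨ ∀ᶠ x in F, ¬ R (f x) (g x) := by
  by_cases hm : m = 0
  · subst hm
    obtain ⟨d, hd⟩ := hf.exists_eventually_eq
    by_cases hR' : ∃ y, R d y
    · obtain ⟨y, hy⟩ := hR'
      refine (hF.eventually_eq_or_ne he hg (.const y)).imp (fun h => ?_) fun h => ?_
      · filter_upwards [h, hd] with x hx hxd
        rwa [hx, hxd]
      · filter_upwards [h, hd] with x hx hxd hr
        exact hx (hfun _ _ _ (hxd ▸ hr) hy)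
    · refine .inr ?_
      filter_upwards [hd] with x hxd hr
      exact hR' ⟨_, hxd ▸ hr⟩
  · exact .inr (hF.eventually_not_rel he hR hfun hf hg hm)

theorem induction_of_eventually_or {p : M → M}
    (hp : ∀ x, x ≠ 0 → x = p x + e) {P : M → Prop}
    (hP : ∀ F : Filter M, F.NeBot → SparseAlong e F → (∀ᶠ x in F, P x) ∨ ∀ᶠ x in F, ¬ P x)
    (zero : P 0) (succ : ∀ x, P x → P (x + e)) (c : M) : P c := by
  by_contra hc
  have up : ∀ n : ℕ, P (n • e) := by
    intro n
    induction n with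
    | zero => simpa using zero
    | succ n ih => rw [succ_nsmul]; exact succ _ ih
  have step : ∀ x, ¬ P x → x = p x + e := fun x hx => hp x fun h => hx (h ▸ zero)
  have down : ∀ n : ℕ, ¬ P (p^[n] c) := by
    intro n
    induction n with
    | zero => exact hc
    | succ n ih =>
      rw [Function.iterate_succ_apply']
      exact fun h => ih (by rw [step _ ih]; exact succ _ h)
  have desc : ∀ n k : ℕ, p^[n] c = p^[n + k] c + k • e := by
    intro n k
    induction k with
    | zero => simp
    | succ k ih =>
      rw [ih, ← add_assoc, Function.iterate_succ_apply', succ_nsmul', ← add_assoc,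
        ← step _ (down _)]
  have hF : SparseAlong e (map (fun n : ℕ => n • e) atTop ⊔ map (fun n : ℕ => p^[n] c) atTop) :=
    (SparseAlong.map_ascending fun n k => add_nsmul e n k).sup (.map_descending desc)
  rcases hP _ inferInstance hF with h | h
  · obtain ⟨n, hn⟩ := (eventually_map.1 (eventually_sup.1 h).2).exists
    exact down n hn
  · obtain ⟨n, hn⟩ := (eventually_map.1 (eventually_sup.1 h).1).exists
    exact hn (up n)

theorem injective_nsmul_of_add_ne_zero (h : ∀ x : M, x + e ≠ 0) :
    Function.Injective fun n : ℕ => n • e := by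
  refine Function.Injective.of_lt_imp_ne fun n m hnm heq => ?_
  obtain ⟨d, rfl⟩ := Nat.exists_eq_add_of_lt hnm
  refine h (d • e) (add_left_cancel (a := n • e) ?_)
  simp only [add_assoc, add_nsmul, one_nsmul, add_zero] at heq ⊢
  exact heq.symm

end Monoid

section Realize

variable {L : FirstOrder.Language.{u, v}} {N : Type*} [L.Structure N]

theorem realize_close1 {α : Type u'} (φ : L.Formula (α ⊕ Fin 1)) (v : α → N) :
    (close1 φ).Realize v ↔ ∀ x, φ.Realize (Sum.elim v fun _ => x) := by
  unfold close1 Formula.Realize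
  rw [BoundedFormula.realize_all]
  refine forall_congr' fun x => ?_
  rw [BoundedFormula.realize_relabel]
  refine iff_of_eq (congrArg₂ _ ?_ (Subsingleton.elim _ _))
  ext (a | i)
  · rfl
  · simp [Fin.snoc]

theorem realize_closeAll {k : ℕ} (φ : L.Formula (Fin k)) :
    N ⊨ closeAll φ ↔ ∀ v : Fin k → N, φ.Realize v := by
  unfold closeAll Sentence.Realize Formula.Realize
  exact BoundedFormula.realize_alls.trans
    (forall_congr' fun v => Formula.realize_relabel_sumInr φ)

theorem realize_indAxiom (zero : L.Constants) (succ : L.Functions 1) {k : ℕ}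
    (ψ : L.Formula (Fin k ⊕ Fin 1)) :
    N ⊨ indAxiom zero succ ψ ↔ ∀ z : Fin k → N, ψ.Realize (Sum.elim z fun _ => (zero : N)) →
      (∀ x, ψ.Realize (Sum.elim z fun _ => x) →
        ψ.Realize (Sum.elim z fun _ => funMap succ ![x])) →
      ∀ x, ψ.Realize (Sum.elim z fun _ => x) := by
  unfold indAxiom
  rw [realize_closeAll]
  refine forall_congr' fun z => ?_
  rw [Formula.realize_imp, Formula.realize_imp, realize_close1, realize_close1]
  simp only [Formula.realize_imp]
  unfold Formula.Realize
  simp only [BoundedFormula.realize_subst]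
  refine imp_congr (iff_of_eq ?_) (imp_congr (forall_congr' fun x => imp_congr_right fun _ =>
    iff_of_eq ?_) Iff.rfl)
  · congr 1
    ext (a | i) <;> simp
  · congr 1
    ext (a | i) <;> simp

end Realize

section Model

variable {N : Type*} [LTri.Structure N]

theorem realize_axioms (hN : N ⊨ TTriI) :
    (∀ x : N, funMap fSucc ![x] ≠ (fZero : N)) ∧
    (funMap fPred ![(fZero : N)] = (fZero : N)) ∧
    (∀ x : N, funMap fPlus ![x, (fZero : N)] = x) ∧
    (∀ x y : N, funMap fPlus ![x, funMap fSucc ![y] ] = funMap fSucc ![funMap fPlus ![x, y] ]) ∧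
    (∀ x y : N, RelMap rTri ![x, y] →
      RelMap rTri ![funMap fSucc ![x], funMap fPlus ![funMap fSucc ![x], y] ]) ∧
    (∀ x y z : N, RelMap rTri ![x, y] → RelMap rTri ![x, z] → y = z) ∧
    (∀ x : N, x ≠ (fZero : N) → x = funMap fSucc ![funMap fPred ![x] ]) ∧
    (∀ x y : N, funMap fPlus ![x, y] = funMap fPlus ![y, x]) ∧
    (∀ x y z : N, funMap fPlus ![funMap fPlus ![x, y], z] =
      funMap fPlus ![x, funMap fPlus ![y, z] ]) ∧
    (∀ x y z : N, funMap fPlus ![x, y] = funMap fPlus ![x, z] → y = z) := by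
  have h1 := hN.realize_of_mem axA1 (by simp [TTriI, TTri])
  have h2 := hN.realize_of_mem axA2 (by simp [TTriI, TTri])
  have h4 := hN.realize_of_mem axA4 (by simp [TTriI, TTri])
  have h5 := hN.realize_of_mem axA5 (by simp [TTriI, TTri])
  have h7 := hN.realize_of_mem axA7 (by simp [TTriI, TTri])
  have h9 := hN.realize_of_mem axA9 (by simp [TTriI, TTri])
  have b1 := hN.realize_of_mem axB1 (by simp [TTriI, TTri])
  have b2 := hN.realize_of_mem axB2 (by simp [TTriI, TTri])
  have b3 := hN.realize_of_mem axB3 (by simp [TTriI, TTri])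
  have b4 := hN.realize_of_mem axB4 (by simp [TTriI, TTri])
  simp [axA1, axA2, axA4, axA5, axA7, axA9, axB1, axB2, axB3, axB4, zT, sT, pT, aT,
    Sentence.Realize, Formula.Realize, Fin.snoc] at h1 h2 h4 h5 h7 h9 b1 b2 b3 b4
  exact ⟨h1, h2, h4, h5, h7, h9, b1, b2, b3, b4⟩

/-- The additive structure of a model of `T_▷^I`. -/
abbrev addCancelCommMonoid (hN : N ⊨ TTriI) : AddCancelCommMonoid N :=
  let _ : Zero N := ⟨(fZero : N)⟩
  let _ : Add N := ⟨fun x y => funMap fPlus ![x, y]⟩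
  { add_assoc := (realize_axioms hN).2.2.2.2.2.2.2.2.1
    add_comm := (realize_axioms hN).2.2.2.2.2.2.2.1
    zero_add := fun x =>
      ((realize_axioms hN).2.2.2.2.2.2.2.1 _ x).trans ((realize_axioms hN).2.2.1 x)
    add_zero := (realize_axioms hN).2.2.1
    nsmul := nsmulRec
    add_left_cancel := (realize_axioms hN).2.2.2.2.2.2.2.2.2 }

theorem succ_eq_add (hN : N ⊨ TTriI) (x : N) :
    letI := addCancelCommMonoid hN
    funMap fSucc ![x] = x + funMap fSucc ![(0 : N)] := by
  let _ := addCancelCommMonoid hN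
  obtain ⟨-, -, -, h5, -⟩ := realize_axioms hN
  exact ((h5 x 0).trans (congrArg (fun y => funMap fSucc ![y]) (add_zero x))).symm

theorem injective_nsmul_succ_zero (hN : N ⊨ TTriI) :
    letI := addCancelCommMonoid hN
    Function.Injective fun n : ℕ => n • funMap fSucc ![(0 : N)] := by
  let _ := addCancelCommMonoid hN
  exact injective_nsmul_of_add_ne_zero fun x => succ_eq_add hN x ▸ (realize_axioms hN).1 x

theorem eventuallyAffine_realize (hN : N ⊨ TTriI) {α : Type*}
    (t : LTri.Term ((α ⊕ Fin 1) ⊕ Fin 0)) (z : α → N) {F : Filter N} [F.NeBot]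
    (hF : letI := addCancelCommMonoid hN; SparseAlong (funMap fSucc ![(0 : N)]) F) :
    letI := addCancelCommMonoid hN
    ∃ m, EventuallyAffine F m
      fun x => t.realize (Sum.elim (Sum.elim z fun _ => x) default) := by
  let _ := addCancelCommMonoid hN
  obtain ⟨-, -, -, -, -, -, b1, -⟩ := realize_axioms hN
  have hs := succ_eq_add hN
  have he := injective_nsmul_succ_zero hN
  induction t with
  | var a =>
    rcases a with (a | i) | i
    · exact ⟨0, .const _⟩
    · exact ⟨1, .id⟩
    · exact i.elim0
  | @func l f ts ih =>
    cases f with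
    | zero => exact ⟨0, .congr (.const (0 : N)) fun x =>
        congrArg (funMap fZero) (Subsingleton.elim _ _)⟩
    | succ =>
      obtain ⟨m, hm⟩ := ih 0
      refine ⟨m + 0, (hm.add (.const (funMap fSucc ![(0 : N)]))).congr fun x => ?_⟩
      rw [← hs]
      exact congrArg (funMap fSucc) (List.ofFn_injective (by simp))
    | pred =>
      obtain ⟨m, hm⟩ := ih 0
      refine ⟨m, (hm.exists_pred hF he (p := fun x => funMap fPred ![x])
        fun x hx => (b1 x hx).trans (hs _)).congr fun x => ?_⟩
      exact congrArg (funMap fPred) (List.ofFn_injective (by simp))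
    | plus =>
      obtain ⟨m, hm⟩ := ih 0
      obtain ⟨m', hm'⟩ := ih 1
      refine ⟨m + m', (hm.add hm').congr fun x => ?_⟩
      exact congrArg (funMap fPlus) (List.ofFn_injective (by simp))

theorem eventually_realize_or_not (hN : N ⊨ TTriI) {α : Type*} {ψ : LTri.Formula (α ⊕ Fin 1)}
    (hψ : ψ.IsQF) (z : α → N) {F : Filter N} [F.NeBot]
    (hF : letI := addCancelCommMonoid hN; SparseAlong (funMap fSucc ![(0 : N)]) F) :
    (∀ᶠ x in F, ψ.Realize (Sum.elim z fun _ => x)) ∨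
      ∀ᶠ x in F, ¬ ψ.Realize (Sum.elim z fun _ => x) := by
  let _ := addCancelCommMonoid hN
  obtain ⟨-, -, -, -, h7, h9, -, -, -, -⟩ := realize_axioms hN
  have hs := succ_eq_add hN
  have he := injective_nsmul_succ_zero hN
  induction hψ with
  | falsum => exact .inr (.of_forall fun _ h => h)
  | of_isAtomic h =>
    cases h with
    | equal t₁ t₂ =>
      obtain ⟨m, hm⟩ := eventuallyAffine_realize hN t₁ z hF
      obtain ⟨m', hm'⟩ := eventuallyAffine_realize hN t₂ z hF
      exact hF.eventually_eq_or_ne he hm hm'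
    | @rel l R ts =>
      cases R
      obtain ⟨m, hm⟩ := eventuallyAffine_realize hN (ts 0) z hF
      obtain ⟨m', hm'⟩ := eventuallyAffine_realize hN (ts 1) z hF
      have key := hF.eventually_rel_or_not_rel he (R := fun x y => RelMap rTri ![x, y])
        (fun x y h => by rw [← hs]; exact h7 x y h) h9 hm hm'
      have hts : ∀ x : N, (fun i => (ts i).realize (Sum.elim (Sum.elim z fun _ => x) default)) =
          ![(ts 0).realize (Sum.elim (Sum.elim z fun _ => x) default),
            (ts 1).realize (Sum.elim (Sum.elim z fun _ => x) default)] := fun x =>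
        List.ofFn_injective (by simp)
      simp only [← hts] at key
      exact key
  | imp _ _ ih₁ ih₂ =>
    rcases ih₂ with h₂ | h₂
    · exact .inl (h₂.mono fun x hx _ => hx)
    · rcases ih₁ with h₁ | h₁
      · exact .inr ((h₁.and h₂).mono fun x hx h => hx.2 (h hx.1))
      · exact .inl (h₁.mono fun x hx h => absurd h hx)

end Model

/-- Every model of `T_▷^I` is a model of `IOpen(L_▷)`: every
`L_▷`-structure satisfying the axioms A1–A9 and B1–B4 satisfies the induction axiom
`Ind_x θ` for every quantifier-free `L_▷`-formula `θ(x,z̄)`. -/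
theorem statement11 (M : Type u) [LTri.Structure M] [Nonempty M] (hM : M ⊨ TTriI) :
    M ⊨ IOpenTh fZero fSucc := by
  rw [Theory.model_iff]
  rintro _ ⟨k, ψ, hψ, rfl⟩
  rw [realize_indAxiom]
  intro z zero succ
  let _ := addCancelCommMonoid hM
  obtain ⟨-, -, -, -, -, -, b1, -⟩ := realize_axioms hM
  have hs := succ_eq_add hM
  exact induction_of_eventually_or
    (p := fun x => funMap fPred ![x]) (fun x hx => (b1 x hx).trans (hs _))
    (fun F _ hF => eventually_realize_or_not hM hψ z hF) zero
    (fun x hx => hs x ▸ succ x hx)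

end TriangularNumbers
end
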